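/- Let 1/2 ≤ γ < 1 and work on the 2D torus 𝕋² with Λ := (-Δ)^{1/2} and Sobolev spaces H^s of mean-zero functions. Let u ∈ H², v = R^⊥u = (-R₂u, R₁u) the Riesz transform vector. Then there exists C > 0 such that ⟨Λ^{2-γ}(v·∇u) - v·∇Λ^{2-γ}u, Λ^{2-γ}u⟩_{L²} ≤ (1/2)‖u‖_{H²}² + C‖u‖_{H^{2-γ}}⁴, where ⟨·,·⟩_{L²} is the L²(𝕋²) inner product. -/

import Mathlib

open scoped ComplexConjugate

noncomputable section

/-- On the 2D torus, working with Fourier coefficients indexed by `ℤ²`: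
the magnitude `|k|` of a frequency. -/
def kmag (k : ℤ × ℤ) : ℝ := Real.sqrt ((k.1 : ℝ) ^ 2 + (k.2 : ℝ) ^ 2)

/-- The Fourier multiplier `Λ^s = (-Δ)^{s/2}`: multiplication by `|k|^s`. -/
def lamPow (s : ℝ) (u : ℤ × ℤ → ℂ) : ℤ × ℤ → ℂ := fun k => (kmag k ^ s : ℝ) * u k

/-- The Riesz transforms `R₁, R₂`: multiplication by `i k_j / |k|`. -/
def riesz1 (u : ℤ × ℤ → ℂ) : ℤ × ℤ → ℂ := fun k => Complex.I * (k.1 : ℂ) / (kmag k : ℂ) * u k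
def riesz2 (u : ℤ × ℤ → ℂ) : ℤ × ℤ → ℂ := fun k => Complex.I * (k.2 : ℂ) / (kmag k : ℂ) * u k

/-- The partial derivatives `∂₁, ∂₂`: multiplication by `i k_j`. -/
def pd1 (u : ℤ × ℤ → ℂ) : ℤ × ℤ → ℂ := fun k => Complex.I * (k.1 : ℂ) * u k
def pd2 (u : ℤ × ℤ → ℂ) : ℤ × ℤ → ℂ := fun k => Complex.I * (k.2 : ℂ) * u k

/-- Pointwise product in physical space = convolution of Fourier coefficients. -/
def convC (f g : ℤ × ℤ → ℂ) : ℤ × ℤ → ℂ := fun k => ∑' j : ℤ × ℤ, f j * g (k - j)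

/-- The transport term `v·∇u` with `v = R^⊥w = (-R₂w, R₁w)`. -/
def transportBy (w u : ℤ × ℤ → ℂ) : ℤ × ℤ → ℂ :=
  fun k => convC (fun j => -(riesz2 w j)) (pd1 u) k + convC (riesz1 w) (pd2 u) k

/-- The (real part of the) `L²(𝕋²)` inner product, via Parseval. -/
def ipL2 (f g : ℤ × ℤ → ℂ) : ℝ := (∑' k : ℤ × ℤ, f k * conj (g k)).re

/-- The Sobolev norm `‖u‖_s = ‖Λ^s u‖_{L²} = (∑ |k|^{2s} |u_k|²)^{1/2}`. -/
def sobNorm (s : ℝ) (u : ℤ × ℤ → ℂ) : ℝ :=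
  Real.sqrt (∑' k : ℤ × ℤ, kmag k ^ (2 * s) * ‖u k‖ ^ 2)

open scoped ENNReal

lemma kmag_eq_norm (k : ℤ × ℤ) : kmag k = ‖(⟨k.1, k.2⟩ : ℂ)‖ := by
  rw [kmag, Complex.norm_def, Complex.normSq_mk, ← pow_two, ← pow_two]

lemma kmag_nonneg (k : ℤ × ℤ) : 0 ≤ kmag k := Real.sqrt_nonneg _

lemma kmag_zero : kmag 0 = 0 := by simp [kmag]

lemma abs_fst_le_kmag (k : ℤ × ℤ) : |(k.1 : ℝ)| ≤ kmag k := by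
  rw [kmag_eq_norm]; exact Complex.abs_re_le_norm ⟨k.1, k.2⟩

lemma abs_snd_le_kmag (k : ℤ × ℤ) : |(k.2 : ℝ)| ≤ kmag k := by
  rw [kmag_eq_norm]; exact Complex.abs_im_le_norm ⟨k.1, k.2⟩

lemma kmag_add_le (j l : ℤ × ℤ) : kmag (j + l) ≤ kmag j + kmag l := by
  simp only [kmag_eq_norm]
  refine le_trans (le_of_eq ?_) (norm_add_le _ _)
  congr 1
  apply Complex.ext <;> simp

lemma kmag_neg (k : ℤ × ℤ) : kmag (-k) = kmag k := by simp [kmag]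

lemma one_le_kmag {k : ℤ × ℤ} (hk : k ≠ 0) : 1 ≤ kmag k := by
  by_cases h : k.1 = 0
  · have h2 : k.2 ≠ 0 := fun h2 => hk (Prod.ext h h2)
    exact le_trans (by exact_mod_cast Int.one_le_abs h2) (abs_snd_le_kmag k)
  · exact le_trans (by exact_mod_cast Int.one_le_abs h) (abs_fst_le_kmag k)

lemma rpow_sub_rpow_le {s x y : ℝ} (hs1 : 1 < s) (hs2 : s ≤ 2) (hy : 0 ≤ y) (hxy : y ≤ x) :
    x ^ s - y ^ s ≤ 2 * x ^ (s - 1) * (x - y) := by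
  rcases hy.eq_or_lt with rfl | hy
  · rcases hxy.eq_or_lt with rfl | hx
    · simp
    · have h : x ^ s = x ^ (s - 1) * x := by
        rw [← Real.rpow_add_one hx.ne']; ring_nf
      rw [Real.zero_rpow (by linarith), h]
      nlinarith [mul_nonneg (Real.rpow_nonneg hx.le (s - 1)) hx.le]
  · have hx : 0 < x := hy.trans_le hxy
    have e1 : x ^ s = x ^ (s - 2) * x ^ 2 := by
      rw [← Real.rpow_natCast, ← Real.rpow_add hx]; norm_num
    have e2 : y ^ s = y ^ (s - 2) * y ^ 2 := by
      rw [← Real.rpow_natCast, ← Real.rpow_add hy]; norm_num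
    have e3 : x ^ (s - 1) = x ^ (s - 2) * x := by
      rw [← Real.rpow_add_one hx.ne']; ring_nf
    have h : x ^ (s - 2) ≤ y ^ (s - 2) :=
      Real.rpow_le_rpow_of_nonpos hy hxy (by linarith)
    have h0 : 0 ≤ x ^ (s - 2) := Real.rpow_nonneg hx.le _
    rw [e1, e2, e3]
    have h1 := mul_le_mul_of_nonneg_right h (sq_nonneg y)
    have h2 := mul_nonneg h0 (sq_nonneg (x - y))
    nlinarith

lemma abs_rpow_sub_rpow_le {s x y d M : ℝ} (hs1 : 1 < s) (hs2 : s ≤ 2) (hx : 0 ≤ x) (hy : 0 ≤ y)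
    (hd : |x - y| ≤ d) (hxM : x ≤ 2 * M) (hyM : y ≤ 2 * M) :
    |x ^ s - y ^ s| ≤ 4 * d * M ^ (s - 1) := by
  wlog hxy : y ≤ x generalizing x y
  · rw [abs_sub_comm]
    exact this hy hx (by rwa [abs_sub_comm]) hyM hxM (not_le.mp hxy).le
  have hM : 0 ≤ M := by linarith
  have hd0 : 0 ≤ d := (abs_nonneg _).trans hd
  have h1 : x ^ (s - 1) ≤ 2 * M ^ (s - 1) := by
    calc x ^ (s - 1) ≤ (2 * M) ^ (s - 1) := Real.rpow_le_rpow hx hxM (by linarith)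
      _ = 2 ^ (s - 1) * M ^ (s - 1) := Real.mul_rpow (by norm_num) hM
      _ ≤ 2 * M ^ (s - 1) := by
        refine mul_le_mul_of_nonneg_right ?_ (Real.rpow_nonneg hM _)
        calc (2 : ℝ) ^ (s - 1) ≤ 2 ^ (1 : ℝ) :=
              Real.rpow_le_rpow_of_exponent_le (by norm_num) (by linarith)
          _ = 2 := Real.rpow_one 2
  rw [abs_of_nonneg (sub_nonneg.mpr (Real.rpow_le_rpow hy hxy (by linarith)))]
  rw [abs_of_nonneg (sub_nonneg.mpr hxy)] at hd
  calc x ^ s - y ^ s ≤ 2 * x ^ (s - 1) * (x - y) := rpow_sub_rpow_le hs1 hs2 hy hxy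
    _ ≤ 2 * (2 * M ^ (s - 1)) * d :=
        mul_le_mul (by linarith) hd (sub_nonneg.mpr hxy)
          (by have := Real.rpow_nonneg hM (s - 1); positivity)
    _ = 4 * d * M ^ (s - 1) := by ring

/-- The box `{-n, …, n}²` in the frequency lattice. -/
def box (n : ℕ) : Finset (ℤ × ℤ) := Finset.Icc (-(n : ℤ)) n ×ˢ Finset.Icc (-(n : ℤ)) n

lemma mem_box_of_kmag_le {j : ℤ × ℤ} {R : ℝ} (h : kmag j ≤ R) : j ∈ box ⌊R⌋₊ := by
  have key : ∀ m : ℤ, |(m : ℝ)| ≤ R → m ∈ Finset.Icc (-(⌊R⌋₊ : ℤ)) ⌊R⌋₊ := by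
    intro m hm
    rw [Finset.mem_Icc, ← abs_le, ← Int.natCast_natAbs]
    have : m.natAbs ≤ ⌊R⌋₊ := Nat.le_floor (by rwa [Nat.cast_natAbs, Int.cast_abs])
    exact_mod_cast this
  exact Finset.mem_product.mpr
    ⟨key _ ((abs_fst_le_kmag j).trans h), key _ ((abs_snd_le_kmag j).trans h)⟩

lemma sum_Icc_inv_sqrt_le (n : ℕ) :
    ∑ m ∈ Finset.Icc (-(n : ℤ)) n, (√(max 1 |(m : ℝ)|))⁻¹ ≤ 1 + 4 * √n := by
  induction n with
  | zero => simp
  | succ n ih =>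
    have e : Finset.Icc (-((n + 1 : ℕ) : ℤ)) (n + 1 : ℕ)
        = insert ((n + 1 : ℕ) : ℤ) (insert (-((n + 1 : ℕ) : ℤ)) (Finset.Icc (-(n : ℤ)) n)) := by
      ext m; simp only [Finset.mem_Icc, Finset.mem_insert]; push_cast; omega
    rw [e, Finset.sum_insert, Finset.sum_insert]
    · have h1 : max 1 |(((n + 1 : ℕ) : ℤ) : ℝ)| = n + 1 := by
        push_cast
        rw [abs_of_nonneg (by positivity), max_eq_right]
        have : (0 : ℝ) ≤ n := by positivity
        linarith
      have h2 : max 1 |((-((n + 1 : ℕ) : ℤ) : ℤ) : ℝ)| = n + 1 := by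
        rw [Int.cast_neg, abs_neg, h1]
      rw [h1, h2]
      push_cast
      have ha : 0 < √((n : ℝ) + 1) := Real.sqrt_pos.mpr (by positivity)
      have hb : 0 ≤ √(n : ℝ) := Real.sqrt_nonneg _
      have hab : √(n : ℝ) ≤ √((n : ℝ) + 1) := Real.sqrt_le_sqrt (by linarith)
      have ha2 : √((n : ℝ) + 1) ^ 2 = n + 1 := Real.sq_sqrt (by positivity)
      have hb2 : √(n : ℝ) ^ 2 = n := Real.sq_sqrt (by positivity)
      have h3 : (√((n : ℝ) + 1))⁻¹ ≤ 2 * (√((n : ℝ) + 1) - √(n : ℝ)) := by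
        rw [inv_le_iff_one_le_mul₀ ha]
        nlinarith
      linarith
    · simp
    · simp only [Finset.mem_insert, Finset.mem_Icc]; push_cast; omega

lemma sum_box_kmag_inv_le {R : ℝ} (hR : 1 ≤ R) : ∑ j ∈ box ⌊R⌋₊, (kmag j)⁻¹ ≤ 25 * R := by
  have h0 : ∀ j : ℤ × ℤ,
      (kmag j)⁻¹ ≤ (√(max 1 |(j.1 : ℝ)|))⁻¹ * (√(max 1 |(j.2 : ℝ)|))⁻¹ := by
    intro j
    rcases eq_or_ne j 0 with rfl | hj
    · simp [kmag_zero]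
    have hk := one_le_kmag hj
    have h1 : √(max 1 |(j.1 : ℝ)|) ≤ √(kmag j) :=
      Real.sqrt_le_sqrt (max_le hk (abs_fst_le_kmag j))
    have h2 : √(max 1 |(j.2 : ℝ)|) ≤ √(kmag j) :=
      Real.sqrt_le_sqrt (max_le hk (abs_snd_le_kmag j))
    have p1 : 0 < √(max 1 |(j.1 : ℝ)|) := Real.sqrt_pos.mpr (by positivity)
    have p2 : 0 < √(max 1 |(j.2 : ℝ)|) := Real.sqrt_pos.mpr (by positivity)
    rw [← mul_inv]
    refine inv_anti₀ (mul_pos p1 p2) ?_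
    calc _ ≤ √(kmag j) * √(kmag j) := mul_le_mul h1 h2 p2.le (Real.sqrt_nonneg _)
      _ = kmag j := Real.mul_self_sqrt (kmag_nonneg j)
  have hn : √((⌊R⌋₊ : ℕ) : ℝ) ≤ √R := Real.sqrt_le_sqrt (Nat.floor_le (by linarith))
  have hR1 : 1 ≤ √R := Real.one_le_sqrt.mpr hR
  have hs := (sum_Icc_inv_sqrt_le ⌊R⌋₊).trans (show _ ≤ 5 * √R by linarith)
  have hs0 : 0 ≤ ∑ m ∈ Finset.Icc (-(⌊R⌋₊ : ℤ)) ⌊R⌋₊, (√(max 1 |(m : ℝ)|))⁻¹ :=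
    Finset.sum_nonneg fun _ _ => by positivity
  calc ∑ j ∈ box ⌊R⌋₊, (kmag j)⁻¹
      ≤ ∑ j ∈ box ⌊R⌋₊, (√(max 1 |(j.1 : ℝ)|))⁻¹ * (√(max 1 |(j.2 : ℝ)|))⁻¹ :=
        Finset.sum_le_sum fun j _ => h0 j
    _ = (∑ m ∈ Finset.Icc (-(⌊R⌋₊ : ℤ)) ⌊R⌋₊, (√(max 1 |(m : ℝ)|))⁻¹) *
        ∑ m ∈ Finset.Icc (-(⌊R⌋₊ : ℤ)) ⌊R⌋₊, (√(max 1 |(m : ℝ)|))⁻¹ := by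
        rw [box, Finset.sum_product, Finset.sum_mul_sum]
    _ ≤ (5 * √R) * (5 * √R) := mul_le_mul hs hs hs0 (by positivity)
    _ = 25 * (√R * √R) := by ring
    _ = 25 * R := by rw [Real.mul_self_sqrt (by linarith)]

lemma sum_ball_kmag_rpow_le {α R : ℝ} (hα0 : 0 < α) (hα1 : α ≤ 1) (hR : 1 ≤ R) :
    ∑ j ∈ (box ⌊R⌋₊).filter (fun j => kmag j ≤ R), kmag j ^ (-α) ≤ 25 * R ^ (2 - α) := by
  have hR0 : 0 < R := by linarith
  calc ∑ j ∈ (box ⌊R⌋₊).filter (fun j => kmag j ≤ R), kmag j ^ (-α)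
      ≤ ∑ j ∈ (box ⌊R⌋₊).filter (fun j => kmag j ≤ R), R ^ (1 - α) * (kmag j)⁻¹ := by
        refine Finset.sum_le_sum fun j hj => ?_
        have hjR : kmag j ≤ R := (Finset.mem_filter.mp hj).2
        rcases eq_or_ne j 0 with rfl | hj0
        · simp [kmag_zero, Real.zero_rpow (neg_ne_zero.mpr hα0.ne')]
        have hk : 0 < kmag j := by linarith [one_le_kmag hj0]
        calc kmag j ^ (-α) = kmag j ^ (1 - α) * (kmag j)⁻¹ := by
              rw [← Real.rpow_neg_one, ← Real.rpow_add hk]; ring_nf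
          _ ≤ R ^ (1 - α) * (kmag j)⁻¹ :=
              mul_le_mul_of_nonneg_right (Real.rpow_le_rpow hk.le hjR (by linarith))
                (inv_nonneg.mpr hk.le)
    _ ≤ ∑ j ∈ box ⌊R⌋₊, R ^ (1 - α) * (kmag j)⁻¹ :=
        Finset.sum_le_sum_of_subset_of_nonneg (Finset.filter_subset _ _) fun j _ _ =>
          mul_nonneg (Real.rpow_nonneg hR0.le _) (inv_nonneg.mpr (kmag_nonneg j))
    _ = R ^ (1 - α) * ∑ j ∈ box ⌊R⌋₊, (kmag j)⁻¹ := by rw [Finset.mul_sum]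
    _ ≤ R ^ (1 - α) * (25 * R) :=
        mul_le_mul_of_nonneg_left (sum_box_kmag_inv_le hR) (Real.rpow_nonneg hR0.le _)
    _ = 25 * R ^ (2 - α) := by
        rw [show 2 - α = (1 - α) + 1 by ring, Real.rpow_add_one hR0.ne']; ring

/-- The paraproduct kernel `|j| |l|^s |u_j| |u_l|`, restricted to `|j| ≤ |l|`. -/
def para (s : ℝ) (u : ℤ × ℤ → ℂ) (j l : ℤ × ℤ) : ℝ :=
  if kmag j ≤ kmag l then kmag j * kmag l ^ s * (‖u j‖ * ‖u l‖) else 0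

lemma para_nonneg (s : ℝ) (u : ℤ × ℤ → ℂ) (j l : ℤ × ℤ) : 0 ≤ para s u j l := by
  unfold para
  split_ifs
  · have := Real.rpow_nonneg (kmag_nonneg l) s
    have := kmag_nonneg j
    positivity
  · exact le_rfl

/-- The amplitude `|k|^s |u_k|`. -/
def amp (s : ℝ) (u : ℤ × ℤ → ℂ) (k : ℤ × ℤ) : ℝ := kmag k ^ s * ‖u k‖

lemma amp_nonneg (s : ℝ) (u : ℤ × ℤ → ℂ) (k : ℤ × ℤ) : 0 ≤ amp s u k :=
  mul_nonneg (Real.rpow_nonneg (kmag_nonneg k) s) (norm_nonneg _)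

lemma amp_sq (s : ℝ) (u : ℤ × ℤ → ℂ) (k : ℤ × ℤ) :
    amp s u k ^ 2 = kmag k ^ (2 * s) * ‖u k‖ ^ 2 := by
  rw [amp, mul_pow, ← Real.rpow_mul_natCast (kmag_nonneg k)]
  norm_num [mul_comm]

lemma sum_para_mul_amp_le {s : ℝ} (hs1 : 1 < s) (hs2 : s ≤ 3 / 2) (u : ℤ × ℤ → ℂ) (hu : u 0 = 0)
    (l : ℤ × ℤ) :
    16 * ∑ j ∈ (box ⌊kmag l⌋₊).filter (fun j => kmag j ≤ kmag l), para s u j l * amp s u (j + l) ≤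
      1 / 2 * amp 2 u l ^ 2 +
        3200 * ∑ j ∈ (box ⌊kmag l⌋₊).filter (fun j => kmag j ≤ kmag l),
          amp s u j ^ 2 * amp s u (j + l) ^ 2 := by
  set S := (box ⌊kmag l⌋₊).filter (fun j => kmag j ≤ kmag l) with hS
  have hQ : 0 ≤ ∑ j ∈ S, amp s u j ^ 2 * amp s u (j + l) ^ 2 :=
    Finset.sum_nonneg fun _ _ => by positivity
  rcases eq_or_ne l 0 with rfl | hl
  · have : ∀ j, para s u j 0 = 0 := fun j => by simp [para, hu]
    simp only [this, zero_mul, Finset.sum_const_zero, mul_zero]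
    positivity
  have hL1 := one_le_kmag hl
  set L := kmag l with hLdef
  have hL : 0 < L := by linarith
  have hterm : ∀ j ∈ S, para s u j l * amp s u (j + l) =
      amp 2 u l * ((L ^ (s - 2) * kmag j ^ (1 - s)) * (amp s u j * amp s u (j + l))) := by
    intro j hj
    rw [para, if_pos (Finset.mem_filter.mp hj).2]
    rcases eq_or_ne j 0 with rfl | hj0
    · simp [amp, hu]
    have hk : 0 < kmag j := by linarith [one_le_kmag hj0]
    have e1 : L ^ s = L ^ (2 : ℝ) * L ^ (s - 2) := by rw [← Real.rpow_add hL]; ring_nf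
    have e2 : kmag j ^ (1 - s) * kmag j ^ s = kmag j := by
      rw [← Real.rpow_add hk]; norm_num
    rw [← hLdef, e1, show amp s u j = kmag j ^ s * ‖u j‖ from rfl,
      show amp 2 u l = L ^ (2 : ℝ) * ‖u l‖ from rfl]
    linear_combination (L ^ (2 : ℝ) * L ^ (s - 2) * ‖u j‖ * ‖u l‖ * amp s u (j + l)) * (-e2)
  rw [Finset.sum_congr rfl hterm, ← Finset.mul_sum]
  set T := ∑ j ∈ S, (L ^ (s - 2) * kmag j ^ (1 - s)) * (amp s u j * amp s u (j + l)) with hT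
  have hw : ∑ j ∈ S, (L ^ (s - 2) * kmag j ^ (1 - s)) ^ 2 ≤ 25 := by
    have e : ∀ j ∈ S, (L ^ (s - 2) * kmag j ^ (1 - s)) ^ 2 =
        L ^ (2 * s - 4) * kmag j ^ (-(2 * s - 2)) := by
      intro j _
      rw [mul_pow, ← Real.rpow_mul_natCast hL.le, ← Real.rpow_mul_natCast (kmag_nonneg j)]
      push_cast
      ring_nf
    rw [Finset.sum_congr rfl e, ← Finset.mul_sum]
    calc _ ≤ L ^ (2 * s - 4) * (25 * L ^ (2 - (2 * s - 2))) :=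
          mul_le_mul_of_nonneg_left
            (sum_ball_kmag_rpow_le (by linarith) (by linarith) hL1) (Real.rpow_nonneg hL.le _)
      _ = 25 * (L ^ (2 * s - 4) * L ^ (2 - (2 * s - 2))) := by ring
      _ = 25 := by rw [← Real.rpow_add hL]; ring_nf; simp
  have hT2 : T ^ 2 ≤ 25 * ∑ j ∈ S, amp s u j ^ 2 * amp s u (j + l) ^ 2 := by
    calc T ^ 2 ≤ (∑ j ∈ S, (L ^ (s - 2) * kmag j ^ (1 - s)) ^ 2) *
          ∑ j ∈ S, (amp s u j * amp s u (j + l)) ^ 2 := Finset.sum_mul_sq_le_sq_mul_sq _ _ _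
      _ ≤ _ := by
        simp only [mul_pow (amp s u _)]
        exact mul_le_mul_of_nonneg_right hw hQ
  nlinarith [sq_nonneg (amp 2 u l - 16 * T)]

lemma tsum_para_mul_amp_le {s : ℝ} (hs1 : 1 < s) (hs2 : s ≤ 3 / 2) (u : ℤ × ℤ → ℂ)
    (hu : u 0 = 0) (l : ℤ × ℤ) :
    16 * ∑' j, ENNReal.ofReal (para s u j l * amp s u (j + l)) ≤
      ENNReal.ofReal (1 / 2 * amp 2 u l ^ 2) +
        3200 * ∑' j, ENNReal.ofReal (amp s u j ^ 2) * ENNReal.ofReal (amp s u (j + l) ^ 2) := by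
  set S := (box ⌊kmag l⌋₊).filter (fun j => kmag j ≤ kmag l) with hS
  have hsupp : ∀ j ∉ S, ENNReal.ofReal (para s u j l * amp s u (j + l)) = 0 := by
    intro j hj
    have : ¬ kmag j ≤ kmag l := fun h =>
      hj (Finset.mem_filter.mpr ⟨mem_box_of_kmag_le h, h⟩)
    simp [para, this]
  have hQ : ∀ j, 0 ≤ amp s u j ^ 2 * amp s u (j + l) ^ 2 := fun _ => by positivity
  rw [tsum_eq_sum hsupp, ← ENNReal.ofReal_sum_of_nonneg fun j _ =>
    mul_nonneg (para_nonneg s u j l) (amp_nonneg s u _)]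
  calc 16 * ENNReal.ofReal (∑ j ∈ S, para s u j l * amp s u (j + l))
      = ENNReal.ofReal (16 * ∑ j ∈ S, para s u j l * amp s u (j + l)) := by
        rw [ENNReal.ofReal_mul (by norm_num)]; norm_num
    _ ≤ ENNReal.ofReal (1 / 2 * amp 2 u l ^ 2 +
          3200 * ∑ j ∈ S, amp s u j ^ 2 * amp s u (j + l) ^ 2) :=
        ENNReal.ofReal_le_ofReal (sum_para_mul_amp_le hs1 hs2 u hu l)
    _ = ENNReal.ofReal (1 / 2 * amp 2 u l ^ 2) + 3200 *
          ∑ j ∈ S, ENNReal.ofReal (amp s u j ^ 2) * ENNReal.ofReal (amp s u (j + l) ^ 2) := by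
        rw [ENNReal.ofReal_add (by positivity)
          (mul_nonneg (by norm_num) (Finset.sum_nonneg fun j _ => hQ j)),
          ENNReal.ofReal_mul (p := 3200) (by norm_num),
          ENNReal.ofReal_sum_of_nonneg fun j _ => hQ j]
        simp only [ENNReal.ofReal_mul (sq_nonneg _)]
        norm_num
    _ ≤ _ := by gcongr; exact ENNReal.sum_le_tsum S

lemma norm_riesz1_le (u : ℤ × ℤ → ℂ) (k : ℤ × ℤ) : ‖riesz1 u k‖ ≤ ‖u k‖ := by
  have h : ‖Complex.I * (k.1 : ℂ) / (kmag k : ℂ)‖ ≤ 1 := by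
    simp only [norm_div, norm_mul, Complex.norm_I, one_mul, Complex.norm_intCast,
      Complex.norm_real, Real.norm_of_nonneg (kmag_nonneg k)]
    exact div_le_one_of_le₀ (abs_fst_le_kmag k) (kmag_nonneg k)
  rw [riesz1, norm_mul]
  exact mul_le_of_le_one_left (norm_nonneg _) h

lemma norm_riesz2_le (u : ℤ × ℤ → ℂ) (k : ℤ × ℤ) : ‖riesz2 u k‖ ≤ ‖u k‖ := by
  have h : ‖Complex.I * (k.2 : ℂ) / (kmag k : ℂ)‖ ≤ 1 := by
    simp only [norm_div, norm_mul, Complex.norm_I, one_mul, Complex.norm_intCast,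
      Complex.norm_real, Real.norm_of_nonneg (kmag_nonneg k)]
    exact div_le_one_of_le₀ (abs_snd_le_kmag k) (kmag_nonneg k)
  rw [riesz2, norm_mul]
  exact mul_le_of_le_one_left (norm_nonneg _) h

lemma norm_pd1_le (u : ℤ × ℤ → ℂ) (k : ℤ × ℤ) : ‖pd1 u k‖ ≤ kmag k * ‖u k‖ := by
  simp only [pd1, norm_mul, Complex.norm_I, one_mul, Complex.norm_intCast]
  exact mul_le_mul_of_nonneg_right (abs_fst_le_kmag k) (norm_nonneg _)

lemma norm_pd2_le (u : ℤ × ℤ → ℂ) (k : ℤ × ℤ) : ‖pd2 u k‖ ≤ kmag k * ‖u k‖ := by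
  simp only [pd2, norm_mul, Complex.norm_I, one_mul, Complex.norm_intCast]
  exact mul_le_mul_of_nonneg_right (abs_snd_le_kmag k) (norm_nonneg _)

lemma norm_lamPow (s : ℝ) (u : ℤ × ℤ → ℂ) (k : ℤ × ℤ) : ‖lamPow s u k‖ = amp s u k := by
  rw [lamPow, norm_mul, Complex.norm_real,
    Real.norm_of_nonneg (Real.rpow_nonneg (kmag_nonneg k) s), amp]

lemma kmag_rpow_le_cube {t : ℝ} (ht0 : 0 < t) (ht3 : t ≤ 3) (k : ℤ × ℤ) :
    kmag k ^ t ≤ kmag k ^ 3 := by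
  rcases eq_or_ne k 0 with rfl | hk
  · simp [kmag_zero, Real.zero_rpow ht0.ne']
  · rw [← Real.rpow_natCast]
    exact Real.rpow_le_rpow_of_exponent_le (one_le_kmag hk) (by norm_num; exact ht3)

/-- Products of an `H²` sequence with three derivatives of it have convergent convolutions. -/
lemma summable_conv {u : ℤ × ℤ → ℂ} (hu : u 0 = 0) (hsum : Summable fun k => amp 2 u k ^ 2)
    (k : ℤ × ℤ) {f g : ℤ × ℤ → ℂ} (hf : ∀ j, ‖f j‖ ≤ ‖u j‖)
    (hg : ∀ j, ‖g j‖ ≤ kmag j ^ 3 * ‖u j‖) : Summable fun j => f j * g (k - j) := by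
  have h2 : Summable fun j => amp 2 u (k - j) ^ 2 :=
    ((Equiv.subLeft k).summable_iff (f := fun k => amp 2 u k ^ 2)).mpr hsum
  refine Summable.of_norm_bounded ((hsum.add h2).mul_left (kmag k + 1)) fun j => ?_
  rw [norm_mul]
  rcases eq_or_ne j 0 with rfl | hj
  · have := hf 0
    rw [hu, norm_zero] at this
    rw [le_antisymm this (norm_nonneg _), zero_mul]
    have := kmag_nonneg k
    positivity
  have hj1 := one_le_kmag hj
  have hk0 := kmag_nonneg k
  have hl0 := kmag_nonneg (k - j)
  have htri : kmag (k - j) ≤ kmag k + kmag j := by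
    rw [sub_eq_add_neg, ← kmag_neg j]; exact kmag_add_le _ _
  have h3 : kmag (k - j) ≤ (kmag k + 1) * kmag j ^ 2 := by
    have hj2 : kmag j ≤ kmag j ^ 2 := le_self_pow₀ hj1 two_ne_zero
    nlinarith [mul_nonneg hk0 (sub_nonneg.mpr (hj1.trans hj2))]
  have ea : ∀ m, amp 2 u m = kmag m ^ 2 * ‖u m‖ := fun m => by
    rw [amp, ← Real.rpow_natCast]; norm_num
  calc ‖f j‖ * ‖g (k - j)‖ ≤ ‖u j‖ * (kmag (k - j) ^ 3 * ‖u (k - j)‖) :=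
        mul_le_mul (hf j) (hg _) (norm_nonneg _) (norm_nonneg _)
    _ = kmag (k - j) * (‖u j‖ * (kmag (k - j) ^ 2 * ‖u (k - j)‖)) := by ring
    _ ≤ (kmag k + 1) * kmag j ^ 2 * (‖u j‖ * (kmag (k - j) ^ 2 * ‖u (k - j)‖)) :=
        mul_le_mul_of_nonneg_right h3 (by positivity)
    _ = (kmag k + 1) * (amp 2 u j * amp 2 u (k - j)) := by rw [ea, ea]; ring
    _ ≤ (kmag k + 1) * (amp 2 u j ^ 2 + amp 2 u (k - j) ^ 2) := by
        refine mul_le_mul_of_nonneg_left ?_ (by linarith)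
        nlinarith [sq_nonneg (amp 2 u j - amp 2 u (k - j)), sq_nonneg (amp 2 u j + amp 2 u (k - j))]

lemma commutator_eq {s : ℝ} (hs0 : 0 < s) (hs2 : s ≤ 2) {u : ℤ × ℤ → ℂ} (hu : u 0 = 0)
    (hsum : Summable fun k => amp 2 u k ^ 2) (k : ℤ × ℤ) :
    lamPow s (transportBy u u) k - transportBy u (lamPow s u) k =
      ∑' j, ((kmag k ^ s - kmag (k - j) ^ s : ℝ) : ℂ) *
        (-(riesz2 u j) * pd1 u (k - j) + riesz1 u j * pd2 u (k - j)) := by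
  have hr2 : ∀ j, ‖-(riesz2 u j)‖ ≤ ‖u j‖ := fun j => by
    rw [norm_neg]; exact norm_riesz2_le u j
  have hcube : ∀ j, kmag j * ‖u j‖ ≤ kmag j ^ 3 * ‖u j‖ := fun j => by
    have := kmag_rpow_le_cube one_pos (by norm_num) j
    rw [Real.rpow_one] at this
    exact mul_le_mul_of_nonneg_right this (norm_nonneg _)
  have hcube' : ∀ j, kmag j * ‖lamPow s u j‖ ≤ kmag j ^ 3 * ‖u j‖ := fun j => by
    rw [norm_lamPow, amp, ← mul_assoc]
    refine mul_le_mul_of_nonneg_right ?_ (norm_nonneg _)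
    refine le_trans (le_of_eq ?_) (kmag_rpow_le_cube (t := s + 1) (by linarith) (by linarith) j)
    rw [Real.rpow_add_one' (kmag_nonneg j) (by linarith), mul_comm]
  have s1 := summable_conv hu hsum k hr2 fun j => (norm_pd1_le u j).trans (hcube j)
  have s2 := summable_conv hu hsum k (norm_riesz1_le u) fun j => (norm_pd2_le u j).trans (hcube j)
  have s3 := summable_conv hu hsum k hr2 fun j => (norm_pd1_le (lamPow s u) j).trans (hcube' j)
  have s4 := summable_conv hu hsum k (norm_riesz1_le u)
    fun j => (norm_pd2_le (lamPow s u) j).trans (hcube' j)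
  rw [lamPow, transportBy, transportBy, convC, convC, convC, convC, ← s1.tsum_add s2,
    ← s3.tsum_add s4, ← tsum_mul_left, ← ((s1.add s2).mul_left _).tsum_sub (s3.add s4)]
  refine tsum_congr fun j => ?_
  simp only [pd1, pd2, lamPow]
  push_cast
  ring

lemma norm_commutator_term_le {s : ℝ} (hs1 : 1 < s) (hs2 : s ≤ 2) (u : ℤ × ℤ → ℂ)
    (k j : ℤ × ℤ) :
    ‖((kmag k ^ s - kmag (k - j) ^ s : ℝ) : ℂ) *
        (-(riesz2 u j) * pd1 u (k - j) + riesz1 u j * pd2 u (k - j))‖ ≤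
      8 * (para s u j (k - j) + para s u (k - j) j) := by
  obtain ⟨l, rfl⟩ : ∃ l, k = j + l := ⟨k - j, by abel⟩
  rw [add_sub_cancel_left]
  have hj := kmag_nonneg j
  have hl := kmag_nonneg l
  have htri := kmag_add_le j l
  have htri' : kmag l ≤ kmag j + kmag (j + l) := by
    have := kmag_add_le (-j) (j + l)
    rwa [kmag_neg, neg_add_cancel_left] at this
  have hd : |kmag (j + l) - kmag l| ≤ kmag j := abs_le.mpr ⟨by linarith, by linarith⟩
  have hm : ‖-(riesz2 u j) * pd1 u l + riesz1 u j * pd2 u l‖ ≤ 2 * (kmag l * (‖u j‖ * ‖u l‖)) := by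
    have h1 := mul_le_mul (norm_riesz2_le u j) (norm_pd1_le u l) (norm_nonneg _) (norm_nonneg _)
    have h2 := mul_le_mul (norm_riesz1_le u j) (norm_pd2_le u l) (norm_nonneg _) (norm_nonneg _)
    refine (norm_add_le _ _).trans ?_
    rw [norm_mul, norm_mul, norm_neg]
    linarith
  have epow : ∀ x : ℝ, 0 ≤ x → x ^ (s - 1) * x = x ^ s := fun x hx => by
    rw [← Real.rpow_add_one' hx (by linarith), sub_add_cancel]
  have hu0 : 0 ≤ ‖u j‖ * ‖u l‖ := by positivity
  rw [norm_mul, Complex.norm_real, Real.norm_eq_abs]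
  rcases le_total (kmag j) (kmag l) with h | h
  · have hb := abs_rpow_sub_rpow_le hs1 hs2 (kmag_nonneg (j + l)) hl hd
      (M := kmag l) (by linarith) (by linarith)
    calc _ ≤ (4 * kmag j * kmag l ^ (s - 1)) * (2 * (kmag l * (‖u j‖ * ‖u l‖))) :=
          mul_le_mul hb hm (norm_nonneg _) ((abs_nonneg _).trans hb)
      _ = 8 * para s u j l := by rw [para, if_pos h, ← epow _ hl]; ring
      _ ≤ _ := by linarith [para_nonneg s u l j]
  · have hb := abs_rpow_sub_rpow_le hs1 hs2 (kmag_nonneg (j + l)) hl hd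
      (M := kmag j) (by linarith) (by linarith)
    calc _ ≤ (4 * kmag j * kmag j ^ (s - 1)) * (2 * (kmag l * (‖u j‖ * ‖u l‖))) :=
          mul_le_mul hb hm (norm_nonneg _) ((abs_nonneg _).trans hb)
      _ = 8 * para s u l j := by rw [para, if_pos h, ← epow _ hj]; ring
      _ ≤ _ := by linarith [para_nonneg s u j l]

/-- Both halves of the symmetrized paraproduct contribute equally after integration. -/
lemma tsum_para_symm (s : ℝ) (u : ℤ × ℤ → ℂ) :
    ∑' k, ∑' j, ENNReal.ofReal (8 * (para s u j (k - j) + para s u (k - j) j) * amp s u k) =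
      ∑' l, 16 * ∑' j, ENNReal.ofReal (para s u j l * amp s u (j + l)) := by
  set F : ℤ × ℤ → ℤ × ℤ → ℝ≥0∞ := fun j l => ENNReal.ofReal (para s u j l * amp s u (j + l)) with hF
  have hsplit : ∀ k j, ENNReal.ofReal (8 * (para s u j (k - j) + para s u (k - j) j) * amp s u k) =
      8 * (F j (k - j) + F (k - j) j) := by
    intro k j
    have h1 := mul_nonneg (para_nonneg s u j (k - j)) (amp_nonneg s u k)
    have h2 := mul_nonneg (para_nonneg s u (k - j) j) (amp_nonneg s u k)
    rw [mul_assoc, add_mul, ENNReal.ofReal_mul (by norm_num), ENNReal.ofReal_add h1 h2]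
    simp [hF]
  have hswap : ∀ k, ∑' j, F (k - j) j = ∑' j, F j (k - j) := fun k => by
    rw [← (Equiv.subLeft k).tsum_eq fun j => F j (k - j)]
    simp
  have hshift : ∑' k, ∑' j, F j (k - j) = ∑' l, ∑' j, F j l := by
    rw [ENNReal.tsum_comm, ENNReal.tsum_comm (f := fun l j => F j l)]
    exact tsum_congr fun j => (Equiv.subRight j).tsum_eq (F j)
  simp only [hsplit, ENNReal.tsum_mul_left, ENNReal.tsum_add, hswap, hshift]
  rw [← two_mul, ← mul_assoc]
  norm_num [hF]

lemma tsum_commutator_le {s : ℝ} (hs1 : 1 < s) (hs2 : s ≤ 3 / 2) {u : ℤ × ℤ → ℂ} (hu : u 0 = 0)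
    (hsum : Summable fun k => amp 2 u k ^ 2) :
    ∑' k, ‖(lamPow s (transportBy u u) k - transportBy u (lamPow s u) k) * conj (lamPow s u k)‖ₑ ≤
      ENNReal.ofReal (1 / 2) * ∑' k, ENNReal.ofReal (amp 2 u k ^ 2) +
        3200 * (∑' k, ENNReal.ofReal (amp s u k ^ 2)) ^ 2 := by
  have hstep : ∀ k,
      ‖(lamPow s (transportBy u u) k - transportBy u (lamPow s u) k) * conj (lamPow s u k)‖ₑ ≤
      ∑' j, ENNReal.ofReal (8 * (para s u j (k - j) + para s u (k - j) j) * amp s u k) := by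
    intro k
    rw [commutator_eq (by linarith) (by linarith) hu hsum, ← tsum_mul_right]
    refine enorm_tsum_le_tsum_enorm.trans (ENNReal.tsum_le_tsum fun j => ?_)
    rw [← ofReal_norm, norm_mul, RCLike.norm_conj, norm_lamPow]
    exact ENNReal.ofReal_le_ofReal (mul_le_mul_of_nonneg_right
      (norm_commutator_term_le hs1 (by linarith) u k j) (amp_nonneg s u k))
  have hconv : ∑' l, ∑' j, ENNReal.ofReal (amp s u j ^ 2) * ENNReal.ofReal (amp s u (j + l) ^ 2) =
      (∑' k, ENNReal.ofReal (amp s u k ^ 2)) ^ 2 := by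
    rw [ENNReal.tsum_comm, sq, ← ENNReal.tsum_mul_right]
    refine tsum_congr fun j => ?_
    rw [ENNReal.tsum_mul_left]
    exact congrArg _ ((Equiv.addLeft j).tsum_eq fun l => ENNReal.ofReal (amp s u l ^ 2))
  calc _ ≤ _ := ENNReal.tsum_le_tsum hstep
    _ = _ := tsum_para_symm s u
    _ ≤ _ := ENNReal.tsum_le_tsum (tsum_para_mul_amp_le hs1 hs2 u hu)
    _ = _ := by
      simp only [ENNReal.ofReal_mul (show (0 : ℝ) ≤ 1 / 2 by norm_num)]
      rw [ENNReal.tsum_add, ENNReal.tsum_mul_left, ENNReal.tsum_mul_left, hconv]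

lemma sobNorm_sq (s : ℝ) (u : ℤ × ℤ → ℂ) : sobNorm s u ^ 2 = ∑' k, amp s u k ^ 2 := by
  simp only [sobNorm, ← amp_sq]
  exact Real.sq_sqrt (tsum_nonneg fun k => sq_nonneg _)

/-- The commutator estimate (3.32) for the quasi-geostrophic equation on `𝕋²` with
`1/2 ≤ γ < 1`: for mean-zero real `u ∈ H²` and `v = R^⊥u`, there is `C > 0` with
`⟨Λ^{2-γ}(v·∇u) - v·∇Λ^{2-γ}u, Λ^{2-γ}u⟩_{L²} ≤ (1/2)‖u‖_{H²}² + C‖u‖_{H^{2-γ}}⁴`. -/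
theorem stmt_19 (γ : ℝ) (hγ1 : 1 / 2 ≤ γ) (hγ2 : γ < 1) :
    ∃ C > (0 : ℝ), ∀ u : ℤ × ℤ → ℂ,
      u 0 = 0 → (∀ k, u (-k) = conj (u k)) →
      Summable (fun k : ℤ × ℤ => kmag k ^ (4 : ℝ) * ‖u k‖ ^ 2) →
      ipL2 (fun k => lamPow (2 - γ) (transportBy u u) k - transportBy u (lamPow (2 - γ) u) k)
          (lamPow (2 - γ) u) ≤
        (1 / 2) * (sobNorm 2 u) ^ 2 + C * (sobNorm (2 - γ) u) ^ 4 := by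
  refine ⟨3200, by norm_num, fun u hu _ hsum => ?_⟩
  have hs1 : 1 < 2 - γ := by linarith
  have hs2 : 2 - γ ≤ 3 / 2 := by linarith
  generalize 2 - γ = s at hs1 hs2 ⊢
  have hsum2 : Summable fun k => amp 2 u k ^ 2 := by
    simp only [amp_sq]
    norm_num
    exact_mod_cast hsum
  have hsums : Summable fun k => amp s u k ^ 2 := by
    refine Summable.of_nonneg_of_le (fun _ => sq_nonneg _) (fun k => ?_) hsum2
    refine pow_le_pow_left₀ (amp_nonneg s u k) ?_ 2
    rcases eq_or_ne k 0 with rfl | hk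
    · simp [amp, hu]
    · exact mul_le_mul_of_nonneg_right
        (Real.rpow_le_rpow_of_exponent_le (one_le_kmag hk) (by linarith)) (norm_nonneg _)
  have h2 : 0 ≤ ∑' k, amp 2 u k ^ 2 := tsum_nonneg fun _ => sq_nonneg _
  have hs : 0 ≤ ∑' k, amp s u k ^ 2 := tsum_nonneg fun _ => sq_nonneg _
  have key := enorm_tsum_le_tsum_enorm.trans (tsum_commutator_le hs1 hs2 hu hsum2)
  rw [← ENNReal.ofReal_tsum_of_nonneg (fun _ => sq_nonneg _) hsum2,
    ← ENNReal.ofReal_tsum_of_nonneg (fun _ => sq_nonneg _) hsums,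
    ← ENNReal.ofReal_mul (by norm_num), ← ENNReal.ofReal_pow hs,
    show (3200 : ℝ≥0∞) = ENNReal.ofReal 3200 by norm_num,
    ← ENNReal.ofReal_mul (by norm_num), ← ENNReal.ofReal_add (by positivity) (by positivity),
    ← ofReal_norm, ENNReal.ofReal_le_ofReal_iff (by positivity)] at key
  rw [ipL2, show sobNorm s u ^ 4 = (sobNorm s u ^ 2) ^ 2 by ring, sobNorm_sq, sobNorm_sq]
  exact (Complex.re_le_norm _).trans key
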